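/- Let G be a finite subgraph of the square lattice with equally many white and black vertices v_1,...,v_N and w_1,...,w_N, with Kasteleyn–Wilson matrix K(G), and suppose G has at least one perfect matching (so that det K(G) ≠ 0 and K(G) is invertible over ℚ). Let e_1,...,e_m be pairwise vertex-disjoint edges of G, where e_s joins the white vertex v_{b_s} to the black vertex w_{c_s}. Then the number of perfect matchings of G that contain all of the edges e_1,...,e_m, divided by the total number of perfect matchings of G, equals the absolute value of the determinant of the m×m matrix whose (s,t) entry is the (c_t, b_s) entry of K(G)^{-1}. -/

import Mathlib

open scoped Classical

/-- Two lattice points are at Euclidean distance 1. -/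
def latAdj (p q : ℤ × ℤ) : Prop := |p.1 - q.1| + |p.2 - q.2| = 1

/-- The graph on `Fin N ⊕ Fin N` (left: white vertices, right: black vertices) determined by
the adjacency relation `E` between white and black indices. -/
def latGraph (N : ℕ) (E : Fin N → Fin N → Prop) : SimpleGraph (Fin N ⊕ Fin N) where
  Adj x y := (∃ i j, x = Sum.inl i ∧ y = Sum.inr j ∧ E i j) ∨
             (∃ i j, x = Sum.inr j ∧ y = Sum.inl i ∧ E i j)
  symm := by
    refine ⟨?_⟩
    rintro x y (⟨i, j, h1, h2, he⟩ | ⟨i, j, h1, h2, he⟩)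
    · exact Or.inr ⟨i, j, h2, h1, he⟩
    · exact Or.inl ⟨i, j, h2, h1, he⟩
  loopless := by
    refine ⟨?_⟩
    rintro x (⟨i, j, h1, h2, -⟩ | ⟨i, j, h1, h2, -⟩) <;> subst h1 <;> simp at h2

/-- The Kasteleyn–Wilson matrix entry at `(i,j)`: `0` if `{v i, w j}` is not an edge;
`1` if it is a horizontal edge; `(-1)^k` if it is a vertical edge joining `(a,l)` to
`(a,l+1)`, where `k` is the number of vertices of the graph with second coordinate `l`
and first coordinate strictly less than `a`. -/
noncomputable def kastEntry (N : ℕ) (v w : Fin N → ℤ × ℤ) (E : Fin N → Fin N → Prop)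
    (i j : Fin N) : ℤ :=
  if E i j then
    if (v i).2 = (w j).2 then 1
    else (-1) ^ (Nat.card {u : Fin N ⊕ Fin N //
        (Sum.elim v w u).2 = min (v i).2 (w j).2 ∧ (Sum.elim v w u).1 < (v i).1})
  else 0

/-- The number of perfect matchings of the induced subgraph of `G` on the vertex set `S`. -/
noncomputable def matchCount {V : Type*} (G : SimpleGraph V) (S : Set V) : ℕ :=
  Nat.card {M : G.Subgraph // M.verts = S ∧ M.IsMatching}


/-- The order sign of two lattice points for the order "by rows, then from left to right". -/
def rowSign (p q : ℤ × ℤ) : ℤ :=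
  if p.2 < q.2 ∨ (p.2 = q.2 ∧ p.1 < q.1) then 1 else if p = q then 0 else -1

/-- The contribution of the vertex `r` to the Kasteleyn–Wilson sign of the edge `{p, q}`. -/
def leftSign (p q r : ℤ × ℤ) : ℤ :=
  if p.2 ≠ q.2 ∧ r.2 = min p.2 q.2 ∧ r.1 < p.1 then -1 else 1

/-- A sign on pairs of vertices, depending only on rows, whose product over the endpoints of two
edges is the `stackSign` of the edges. -/
def heightSign (p q : ℤ × ℤ) : ℤ := (-1) ^ (p.2 - q.2 + 1).toNat

/-- `-1` if both edges are vertical and the second starts one row above the first. -/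
def stackSign (p q p' q' : ℤ × ℤ) : ℤ :=
  if p.2 ≠ q.2 ∧ p'.2 ≠ q'.2 ∧ min p'.2 q'.2 = min p.2 q.2 + 1 then -1 else 1

/-- `q` is the right or upper neighbour of `p`. -/
def IsStep (p q : ℤ × ℤ) : Prop := q = (p.1 + 1, p.2) ∨ q = (p.1, p.2 + 1)

theorem latAdj.isStep {p q : ℤ × ℤ} (h : latAdj p q) : IsStep p q ∨ IsStep q p := by
  obtain ⟨a, b⟩ := p
  obtain ⟨c, d⟩ := q
  simp only [latAdj, IsStep, Prod.mk.injEq] at *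
  grind

theorem rowSign_antisymm (p q : ℤ × ℤ) : rowSign p q = -rowSign q p := by
  obtain ⟨a, b⟩ := p
  obtain ⟨c, d⟩ := q
  simp only [rowSign, Prod.mk.injEq]
  grind

theorem rowSign_ne_zero {p q : ℤ × ℤ} (h : p ≠ q) : rowSign p q ≠ 0 := by
  unfold rowSign
  split_ifs <;> simp

theorem leftSign_comm {p q : ℤ × ℤ} (h : latAdj p q) (r : ℤ × ℤ) :
    leftSign p q r = leftSign q p r := by
  obtain ⟨a, b⟩ := p
  obtain ⟨c, d⟩ := q
  simp only [latAdj, leftSign] at *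
  grind

theorem stackSign_comm_left (p q p' q' : ℤ × ℤ) :
    stackSign p q p' q' = stackSign q p p' q' := by
  simp only [stackSign, min_comm p.2 q.2, ne_comm (a := p.2)]

theorem stackSign_comm_right (p q p' q' : ℤ × ℤ) :
    stackSign p q p' q' = stackSign p q q' p' := by
  simp only [stackSign, min_comm p'.2 q'.2, ne_comm (a := p'.2)]

theorem heightSign_mul_of_isStep {p q : ℤ × ℤ} (h : IsStep p q) (r : ℤ × ℤ) :
    heightSign p r * heightSign q r = if p.2 ≠ q.2 ∧ r.2 ≤ p.2 + 1 then -1 else 1 := by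
  obtain ⟨a, b⟩ := p
  obtain ⟨c, d⟩ := r
  unfold heightSign
  rcases h with rfl | rfl
  · simp [← pow_add, ← two_mul]
  · simp only [← pow_add]
    by_cases hd : d ≤ b + 1
    · have : (b + 1 - d + 1).toNat = (b - d + 1).toNat + 1 := by omega
      rw [this, show ∀ n : ℕ, n + (n + 1) = 2 * n + 1 by intro n; ring]
      simp [hd, pow_succ]
    · have h1 : (b + 1 - d + 1).toNat = 0 := by omega
      have h2 : (b - d + 1).toNat = 0 := by omega
      simp [h1, h2, hd]

theorem heightSign_prod_of_isStep {p q p' q' : ℤ × ℤ} (h : IsStep p q) (h' : IsStep p' q') :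
    (heightSign p p' * heightSign q p') * (heightSign p q' * heightSign q q') =
      stackSign p q p' q' := by
  rw [heightSign_mul_of_isStep h, heightSign_mul_of_isStep h]
  obtain ⟨a, b⟩ := p
  obtain ⟨c, d⟩ := p'
  rcases h with rfl | rfl <;> rcases h' with rfl | rfl <;> simp only [stackSign] <;> grind

theorem heightSign_prod {p q p' q' : ℤ × ℤ} (h : latAdj p q) (h' : latAdj p' q') :
    heightSign p p' * heightSign p q' * (heightSign q p' * heightSign q q') =
      stackSign p q p' q' := by
  rcases h.isStep with h | h <;> rcases h'.isStep with h' | h'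
  · rw [← heightSign_prod_of_isStep h h']; ring
  · rw [stackSign_comm_right, ← heightSign_prod_of_isStep h h']; ring
  · rw [stackSign_comm_left, ← heightSign_prod_of_isStep h h']; ring
  · rw [stackSign_comm_left, stackSign_comm_right, ← heightSign_prod_of_isStep h h']; ring

theorem crossing_of_isStep {p q p' q' : ℤ × ℤ} (h : IsStep p q) (h' : IsStep p' q')
    (h1 : p ≠ p') (h2 : p ≠ q') (h3 : q ≠ p') (h4 : q ≠ q') :
    rowSign p p' * rowSign p q' * (rowSign q p' * rowSign q q') *
        (leftSign p q p' * leftSign p q q' * (leftSign p' q' p * leftSign p' q' q)) =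
      stackSign p q p' q' * stackSign p' q' p q := by
  obtain ⟨a, b⟩ := p
  obtain ⟨c, d⟩ := p'
  simp only [rowSign, h1, h2, h3, h4, if_false]
  rcases h with rfl | rfl <;> rcases h' with rfl | rfl <;>
    simp only [stackSign, leftSign, ne_eq, Prod.mk.injEq, min_eq_left (Int.le_add_one le_rfl)] at * <;>
    grind (splits := 25)

/-- The crossing parity of two disjoint lattice edges, corrected by the Kasteleyn–Wilson signs. -/
theorem crossing {p q p' q' : ℤ × ℤ} (h : latAdj p q) (h' : latAdj p' q')
    (h1 : p ≠ p') (h2 : p ≠ q') (h3 : q ≠ p') (h4 : q ≠ q') :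
    rowSign p p' * rowSign p q' * (rowSign q p' * rowSign q q') *
        (leftSign p q p' * leftSign p q q' * (leftSign p' q' p * leftSign p' q' q)) =
      stackSign p q p' q' * stackSign p' q' p q := by
  rcases h.isStep with k | k <;> rcases h'.isStep with k' | k'
  · exact crossing_of_isStep k k' h1 h2 h3 h4
  · rw [stackSign_comm_right, stackSign_comm_left p', ← crossing_of_isStep k k' h2 h1 h4 h3,
      leftSign_comm h', leftSign_comm h']
    ring
  · rw [stackSign_comm_left, stackSign_comm_right p', ← crossing_of_isStep k k' h3 h4 h1 h2,
      leftSign_comm h, leftSign_comm h]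
    ring
  · rw [stackSign_comm_left, stackSign_comm_right, stackSign_comm_left p', stackSign_comm_right q',
      ← crossing_of_isStep k k' h4 h3 h2 h1, leftSign_comm h, leftSign_comm h, leftSign_comm h',
      leftSign_comm h']
    ring

theorem leftSign_self {p q : ℤ × ℤ} (h : latAdj p q) :
    leftSign p q p * leftSign p q q = 1 := by
  obtain ⟨a, b⟩ := p
  obtain ⟨c, d⟩ := q
  simp only [latAdj, leftSign] at *
  grind

theorem stackSign_self (p q : ℤ × ℤ) : stackSign p q p q = 1 := by
  simp [stackSign]

theorem rowSign_eq_of_parity {p q : ℤ × ℤ} (h : latAdj p q) (hp : Even (p.1 + p.2))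
    (hq : Odd (q.1 + q.2)) :
    rowSign p q = (if Even ((p.1 + p.2) / 2) then 1 else -1) *
      (if Even ((q.1 + q.2) / 2) then 1 else -1) := by
  obtain ⟨x, hx⟩ := hp
  obtain ⟨y, hy⟩ := hq
  rw [show (p.1 + p.2) / 2 = x by omega, show (q.1 + q.2) / 2 = y by omega]
  obtain ⟨a, b⟩ := p
  obtain ⟨c, d⟩ := q
  simp only [latAdj, rowSign, Prod.mk.injEq, Int.even_iff] at *
  grind

theorem prod_prod_eq_diag_mul {R : Type*} [CommRing R] {n : ℕ} (f : Fin n → Fin n → R) :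
    ∏ i, ∏ j, f i j = (∏ i, f i i) * ∏ i, ∏ j ∈ Finset.Ioi i, f i j * f j i := by
  rw [Finset.prod_prod_Ioi_mul_eq_prod_prod_off_diag (fun i j => f j i), ← Finset.prod_mul_distrib]
  refine Finset.prod_congr rfl fun i _ => ?_
  rw [Fintype.prod_eq_mul_prod_compl i]

section KasteleynSign

variable {N : ℕ} {v w : Fin N → ℤ × ℤ} {E : Fin N → Fin N → Prop}

theorem kastEntry_eq_prod {i j : Fin N} (h : E i j) (σ : Equiv.Perm (Fin N)) :
    kastEntry N v w E i j =
      ∏ k, leftSign (v i) (w j) (v k) * leftSign (v i) (w j) (w (σ k)) := by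
  rw [Finset.prod_mul_distrib, Equiv.prod_comp σ fun k => leftSign (v i) (w j) (w k)]
  have := Fintype.prod_sum_type fun u => leftSign (v i) (w j) (Sum.elim v w u)
  simp only [Sum.elim_inl, Sum.elim_inr] at this
  rw [← this, kastEntry, if_pos h]
  by_cases hij : (v i).2 = (w j).2
  · simp [hij, leftSign]
  · simp only [hij, leftSign, if_false, ne_eq, not_false_eq_true, true_and, Finset.prod_ite,
      Finset.prod_const, one_pow, mul_one]
    rw [Nat.card_eq_fintype_card, Fintype.card_subtype]

theorem kastEntry_eq_zero {i j : Fin N} (h : ¬ E i j) : kastEntry N v w E i j = 0 :=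
  if_neg h

theorem abs_kastEntry {i j : Fin N} (h : E i j) : |kastEntry N v w E i j| = 1 := by
  rw [kastEntry, if_pos h]
  split_ifs <;> simp

/-- All perfect matchings contribute the same sign to the determinant. -/
theorem kasteleyn_sign_eq
    (hwhite : ∀ i, Even ((v i).1 + (v i).2)) (hblack : ∀ j, Odd ((w j).1 + (w j).2))
    (hv : Function.Injective v) (hw : Function.Injective w)
    (hE : ∀ i j, E i j → latAdj (v i) (w j)) {σ τ : Equiv.Perm (Fin N)}
    (hσ : ∀ i, E i (σ i)) (hτ : ∀ i, E i (τ i)) :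
    (Equiv.Perm.sign σ : ℤ) * ∏ i, kastEntry N v w E i (σ i) =
      (Equiv.Perm.sign τ : ℤ) * ∏ i, kastEntry N v w E i (τ i) := by
  have hvw : ∀ i j, v i ≠ w j := fun i j h => by
    have h1 := hwhite i
    rw [h] at h1
    exact (Int.not_even_iff_odd.2 (hblack j)) h1
  have key : ∀ σ : Equiv.Perm (Fin N), (∀ i, E i (σ i)) →
      ((Equiv.Perm.sign σ : ℤ) * ∏ i, kastEntry N v w E i (σ i)) *
        ((∏ i, ∏ j ∈ Finset.Ioi i, rowSign (v i) (v j)) *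
          (∏ i, ∏ j ∈ Finset.Ioi i, rowSign (w i) (w j)) *
          (∏ i : Fin N, ∏ _j ∈ Finset.Ioi i, (-1 : ℤ)) * ∏ i, ∏ j, rowSign (v i) (w j)) =
      ((∏ i, if Even (((v i).1 + (v i).2) / 2) then 1 else -1) *
        ∏ i, if Even (((w i).1 + (w i).2) / 2) then 1 else -1) *
        (((∏ i, ∏ j, heightSign (v i) (v j)) * ∏ i, ∏ j, heightSign (v i) (w j)) *
          ((∏ i, ∏ j, heightSign (w i) (v j)) * ∏ i, ∏ j, heightSign (w i) (w j))) := by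
    intro σ hσ
    have hadj := fun i => hE i (σ i) (hσ i)
    have hdiag : ∏ i, rowSign (v i) (w (σ i)) =
        (∏ i, if Even (((v i).1 + (v i).2) / 2) then 1 else -1) *
        ∏ i, if Even (((w i).1 + (w i).2) / 2) then 1 else -1 := by
      rw [← Equiv.prod_comp σ fun i => if Even (((w i).1 + (w i).2) / 2) then (1 : ℤ) else -1,
        ← Finset.prod_mul_distrib]
      exact Finset.prod_congr rfl fun i _ => rowSign_eq_of_parity (hadj i) (hwhite _) (hblack _)
    have hcross := prod_prod_eq_diag_mul fun i j => rowSign (v i) (w (σ j))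
    have hre : ∏ i, ∏ j, rowSign (v i) (w (σ j)) = ∏ i, ∏ j, rowSign (v i) (w j) :=
      Finset.prod_congr rfl fun i _ => Equiv.prod_comp σ fun j => rowSign (v i) (w j)
    have hsign := Equiv.Perm.prod_Ioi_comp_eq_sign_mul_prod
      σ (f := fun i j => rowSign (w i) (w j)) fun i j => rowSign_antisymm _ _
    have hK : ∏ i, kastEntry N v w E i (σ i) = ∏ i, ∏ j ∈ Finset.Ioi i,
        (leftSign (v i) (w (σ i)) (v j) * leftSign (v i) (w (σ i)) (w (σ j))) *
        (leftSign (v j) (w (σ j)) (v i) * leftSign (v j) (w (σ j)) (w (σ i))) := by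
      rw [Finset.prod_congr rfl fun i _ => kastEntry_eq_prod (hσ i) σ, prod_prod_eq_diag_mul,
        Finset.prod_eq_one fun i _ => leftSign_self (hadj i), one_mul]
    have hstack : ∏ i, ∏ j, stackSign (v i) (w (σ i)) (v j) (w (σ j)) =
        ((∏ i, ∏ j, heightSign (v i) (v j)) * ∏ i, ∏ j, heightSign (v i) (w j)) *
          ((∏ i, ∏ j, heightSign (w i) (v j)) * ∏ i, ∏ j, heightSign (w i) (w j)) := by
      rw [← Equiv.prod_comp σ fun i => ∏ j, heightSign (w i) (v j),
        ← Equiv.prod_comp σ fun i => ∏ j, heightSign (w i) (w j),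
        ← Finset.prod_congr rfl fun i _ => Equiv.prod_comp σ fun j => heightSign (v i) (w j),
        ← Finset.prod_congr rfl fun i _ => Equiv.prod_comp σ fun j => heightSign (w (σ i)) (w j)]
      simp only [← Finset.prod_mul_distrib]
      exact Finset.prod_congr rfl fun i _ => Finset.prod_congr rfl fun j _ =>
        (heightSign_prod (hadj i) (hadj j)).symm
    rw [prod_prod_eq_diag_mul, Finset.prod_eq_one fun i _ => stackSign_self _ _, one_mul] at hstack
    have hpair : (∏ i, ∏ j ∈ Finset.Ioi i, rowSign (v i) (v j)) *
          (∏ i, ∏ j ∈ Finset.Ioi i, rowSign (w (σ i)) (w (σ j))) *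
          (∏ i : Fin N, ∏ _j ∈ Finset.Ioi i, (-1 : ℤ)) *
          (∏ i, ∏ j ∈ Finset.Ioi i, rowSign (v i) (w (σ j)) * rowSign (v j) (w (σ i))) *
          (∏ i, kastEntry N v w E i (σ i)) =
        ∏ i, ∏ j ∈ Finset.Ioi i, stackSign (v i) (w (σ i)) (v j) (w (σ j)) *
          stackSign (v j) (w (σ j)) (v i) (w (σ i)) := by
      rw [hK]
      simp only [← Finset.prod_mul_distrib]
      refine Finset.prod_congr rfl fun i _ => Finset.prod_congr rfl fun j hj => ?_
      have hij : i ≠ j := (Finset.mem_Ioi.1 hj).ne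
      rw [← crossing (hadj i) (hadj j) (hv.ne hij) (hvw _ _) (hvw _ _).symm
        (hw.ne (σ.injective.ne hij)), rowSign_antisymm (v j) (w (σ i))]
      ring
    rw [Int.cast_id] at hsign
    rw [← hdiag, ← hstack, ← hpair, hsign, ← hre, hcross]
    ring
  have hne : (∏ i, ∏ j ∈ Finset.Ioi i, rowSign (v i) (v j)) *
          (∏ i, ∏ j ∈ Finset.Ioi i, rowSign (w i) (w j)) *
          (∏ i : Fin N, ∏ _j ∈ Finset.Ioi i, (-1 : ℤ)) * ∏ i, ∏ j, rowSign (v i) (w j) ≠ 0 := by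
    refine mul_ne_zero (mul_ne_zero (mul_ne_zero ?_ ?_) ?_) ?_ <;>
      refine Finset.prod_ne_zero_iff.2 fun i _ => Finset.prod_ne_zero_iff.2 fun j hj => ?_
    · exact rowSign_ne_zero (hv.ne (Finset.mem_Ioi.1 hj).ne)
    · exact rowSign_ne_zero (hw.ne (Finset.mem_Ioi.1 hj).ne)
    · norm_num
    · exact rowSign_ne_zero (hvw i j)
  exact mul_right_cancel₀ hne ((key σ hσ).trans (key τ hτ).symm)

end KasteleynSign

/-- The perfect matching of `latGraph N E` given by a permutation. -/
def matchingOfPerm {N : ℕ} {E : Fin N → Fin N → Prop} (σ : Equiv.Perm (Fin N))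
    (h : ∀ i, E i (σ i)) : (latGraph N E).Subgraph where
  verts := Set.univ
  Adj x y := (∃ i, x = Sum.inl i ∧ y = Sum.inr (σ i)) ∨ ∃ i, x = Sum.inr (σ i) ∧ y = Sum.inl i
  adj_sub := by
    rintro x y (⟨i, hx, hy⟩ | ⟨i, hx, hy⟩)
    · exact Or.inl ⟨i, σ i, hx, hy, h i⟩
    · exact Or.inr ⟨i, σ i, hx, hy, h i⟩
  edge_vert _ := Set.mem_univ _
  symm := by
    refine ⟨?_⟩
    rintro x y (⟨i, hx, hy⟩ | ⟨i, hx, hy⟩)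
    · exact Or.inr ⟨i, hy, hx⟩
    · exact Or.inl ⟨i, hy, hx⟩

section Matching

variable {N : ℕ} {E : Fin N → Fin N → Prop}

theorem matchingOfPerm_adj {σ : Equiv.Perm (Fin N)} {h : ∀ i, E i (σ i)} {i j : Fin N} :
    (matchingOfPerm σ h).Adj (Sum.inl i) (Sum.inr j) ↔ σ i = j := by
  simp [matchingOfPerm, eq_comm]

theorem matchingOfPerm_isPerfectMatching (σ : Equiv.Perm (Fin N)) (h : ∀ i, E i (σ i)) :
    (matchingOfPerm σ h).IsPerfectMatching := by
  rw [SimpleGraph.Subgraph.isPerfectMatching_iff]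
  rintro (i | j)
  · exact ⟨Sum.inr (σ i), by simp [matchingOfPerm], by simp [matchingOfPerm]⟩
  · refine ⟨Sum.inl (σ.symm j), by simp [matchingOfPerm], ?_⟩
    rintro y (⟨i, hi, -⟩ | ⟨i, hi, rfl⟩)
    · simp at hi
    · simp [Sum.inr.inj hi]

theorem exists_matchingOfPerm_eq {M : (latGraph N E).Subgraph} (hM : M.IsPerfectMatching) :
    ∃ (σ : Equiv.Perm (Fin N)) (h : ∀ i, E i (σ i)), matchingOfPerm σ h = M := by
  have hM' := SimpleGraph.Subgraph.isPerfectMatching_iff.1 hM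
  have hex : ∀ i, ∃ j, M.Adj (Sum.inl i) (Sum.inr j) := by
    intro i
    obtain ⟨y, hy, -⟩ := hM' (Sum.inl i)
    rcases M.adj_sub hy with ⟨_, j, -, rfl, -⟩ | ⟨_, _, h, -⟩
    · exact ⟨j, hy⟩
    · simp at h
  choose f hf using hex
  have hinj : Function.Injective f := fun i k hik =>
    Sum.inl.inj ((hM' (Sum.inr (f i))).unique (hf i).symm (hik ▸ (hf k).symm))
  have hedge : ∀ i, E i (f i) := by
    intro i
    rcases M.adj_sub (hf i) with ⟨_, _, h1, h2, h⟩ | ⟨_, _, h, -⟩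
    · rwa [← Sum.inl.inj h1, ← Sum.inr.inj h2] at h
    · simp at h
  refine ⟨Equiv.ofBijective f (Finite.injective_iff_bijective.1 hinj), hedge, ?_⟩
  have hadj : ∀ i j, M.Adj (Sum.inl i) (Sum.inr j) → f i = j := fun i j h =>
    Sum.inr.inj ((hM' (Sum.inl i)).unique (hf i) h)
  refine SimpleGraph.Subgraph.ext (Set.eq_univ_of_forall hM.2).symm ?_
  ext x y
  constructor
  · rintro (⟨i, rfl, rfl⟩ | ⟨i, rfl, rfl⟩)
    · exact hf i
    · exact (hf i).symm
  · intro h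
    rcases M.adj_sub h with ⟨i, j, rfl, rfl, -⟩ | ⟨i, j, rfl, rfl, -⟩
    · exact Or.inl ⟨i, rfl, congrArg Sum.inr (hadj i j h).symm⟩
    · exact Or.inr ⟨i, congrArg Sum.inr (hadj i j h.symm).symm, rfl⟩

theorem card_perfectMatching_eq {m : ℕ} (b c : Fin m → Fin N) :
    Nat.card {M : (latGraph N E).Subgraph //
        M.IsPerfectMatching ∧ ∀ s, M.Adj (Sum.inl (b s)) (Sum.inr (c s))} =
      Nat.card {σ : Equiv.Perm (Fin N) // (∀ i, E i (σ i)) ∧ ∀ s, σ (b s) = c s} := by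
  symm
  refine Nat.card_congr (Equiv.ofBijective (fun σ => ⟨matchingOfPerm σ.1 σ.2.1,
    matchingOfPerm_isPerfectMatching _ _, fun s => matchingOfPerm_adj.2 (σ.2.2 s)⟩) ⟨?_, ?_⟩)
  · rintro ⟨σ, hσ⟩ ⟨τ, hτ⟩ h
    refine Subtype.ext (Equiv.ext fun i => ?_)
    have h' : matchingOfPerm σ hσ.1 = matchingOfPerm τ hτ.1 := Subtype.ext_iff.1 h
    exact (matchingOfPerm_adj (h := hσ.1)).1 (h' ▸ matchingOfPerm_adj.2 rfl)
  · rintro ⟨M, hM, hbc⟩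
    obtain ⟨σ, h, rfl⟩ := exists_matchingOfPerm_eq hM
    exact ⟨⟨σ, h, fun s => matchingOfPerm_adj.1 (hbc s)⟩, rfl⟩

end Matching

section Determinant

variable {n ι R : Type*} [DecidableEq n] [Fintype ι] [CommRing R]

/-- The matrix `K` with the row `b s` replaced by the unit vector at `c s`, for each `s`. -/
noncomputable def replaceRows (K : Matrix n n R) (b c : ι → n) : Matrix n n R :=
  Matrix.of fun i j => if i ∈ Finset.univ.image b then (if ∃ s, b s = i ∧ c s = j then 1 else 0)
    else K i j

theorem replaceRows_eq [DecidableEq ι] (K : Matrix n n R) {b : ι → n}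
    (hb : Function.Injective b) (c : ι → n) :
    replaceRows K b c = K + (1 : Matrix n n R).submatrix id b *
      ((1 : Matrix n n R).submatrix c id - K.submatrix b id) := by
  ext i j
  simp only [replaceRows, Matrix.of_apply, Matrix.add_apply, Matrix.mul_apply, Matrix.sub_apply,
    Matrix.submatrix_apply, id, Matrix.one_apply]
  by_cases hi : i ∈ Finset.univ.image b
  · obtain ⟨s, -, rfl⟩ := Finset.mem_image.1 hi
    simp [hb.eq_iff]
  · have : ∀ s, i ≠ b s := fun s h => hi (Finset.mem_image.2 ⟨s, Finset.mem_univ _, h.symm⟩)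
    rw [if_neg hi, Finset.sum_eq_zero, add_zero]
    intro s _
    rw [if_neg (this s), zero_mul]

theorem det_replaceRows [Fintype n] [DecidableEq ι] (K : Matrix n n R) (hK : IsUnit K.det) {b : ι → n}
    (hb : Function.Injective b) (c : ι → n) :
    (replaceRows K b c).det = (K⁻¹.submatrix c b).det * K.det := by
  have h : replaceRows K b c = (1 + (1 : Matrix n n R).submatrix id b *
      (K⁻¹.submatrix c id - (1 : Matrix n n R).submatrix b id)) * K := by
    rw [replaceRows_eq K hb, Matrix.add_mul, Matrix.one_mul, Matrix.mul_assoc, Matrix.sub_mul]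
    congr 3
    · rw [← Matrix.nonsing_inv_mul K hK]
      rfl
    · ext s j
      simp [Matrix.mul_apply, Matrix.one_apply]
  rw [h, Matrix.det_mul, Matrix.det_one_add_mul_comm, Matrix.sub_mul]
  congr 2
  have h1 : K⁻¹.submatrix c id * (1 : Matrix n n R).submatrix id b = K⁻¹.submatrix c b := by
    ext s t
    simp [Matrix.mul_apply, Matrix.one_apply]
  have h2 : (1 : Matrix n n R).submatrix b id * (1 : Matrix n n R).submatrix id b = 1 := by
    ext s t
    simp [Matrix.mul_apply, Matrix.one_apply, hb.eq_iff]
  rw [h1, h2, add_sub_cancel]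

theorem prod_replaceRows [Fintype n] (K : Matrix n n R) {b : ι → n} (hb : Function.Injective b) (c : ι → n)
    (σ : Equiv.Perm n) :
    (∏ i, replaceRows K b c i (σ i)) * ∏ s, K (b s) (c s) =
      if ∀ s, σ (b s) = c s then ∏ i, K i (σ i) else 0 := by
  split_ifs with h
  · have : ∏ s, K (b s) (c s) = ∏ i, if i ∈ Finset.univ.image b then K i (σ i) else 1 := by
      rw [Finset.prod_ite_mem, Finset.univ_inter, Finset.prod_image hb.injOn]
      simp [h]
    rw [this, ← Finset.prod_mul_distrib]
    refine Finset.prod_congr rfl fun i _ => ?_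
    by_cases hi : i ∈ Finset.univ.image b
    · obtain ⟨s, -, rfl⟩ := Finset.mem_image.1 hi
      simp [replaceRows, h, hb.eq_iff]
    · rw [if_neg hi, mul_one, replaceRows, Matrix.of_apply, if_neg hi]
  · push Not at h
    obtain ⟨s, hs⟩ := h
    rw [Finset.prod_eq_zero (Finset.mem_univ (b s)), zero_mul]
    simp [replaceRows, hb.eq_iff, hs.symm]

end Determinant

/-- The number of perfect matchings containing prescribed disjoint edges is the absolute value of
the determinant of the Kasteleyn–Wilson matrix with the corresponding rows replaced. -/
theorem card_perm_eq_abs_det {N m : ℕ} {v w : Fin N → ℤ × ℤ} {E : Fin N → Fin N → Prop}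
    (hwhite : ∀ i, Even ((v i).1 + (v i).2)) (hblack : ∀ j, Odd ((w j).1 + (w j).2))
    (hv : Function.Injective v) (hw : Function.Injective w)
    (hE : ∀ i j, E i j → latAdj (v i) (w j))
    {τ : Equiv.Perm (Fin N)} (hτ : ∀ i, E i (τ i))
    {b c : Fin m → Fin N} (hb : Function.Injective b) (hbc : ∀ s, E (b s) (c s)) :
    (Nat.card {σ : Equiv.Perm (Fin N) // (∀ i, E i (σ i)) ∧ ∀ s, σ (b s) = c s} : ℤ) =
      |(replaceRows (Matrix.of (kastEntry N v w E)) b c).det| := by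
  have hdet : (replaceRows (Matrix.of (kastEntry N v w E)) b c).det *
      ∏ s, kastEntry N v w E (b s) (c s) =
      Nat.card {σ : Equiv.Perm (Fin N) // (∀ i, E i (σ i)) ∧ ∀ s, σ (b s) = c s} *
        ((Equiv.Perm.sign τ : ℤ) * ∏ i, kastEntry N v w E i (τ i)) := by
    rw [← Matrix.det_transpose, Matrix.det_apply', Finset.sum_mul, Nat.card_eq_fintype_card,
      Fintype.card_subtype, ← nsmul_eq_mul, ← Finset.sum_const, Finset.sum_filter]
    refine Finset.sum_congr rfl fun σ _ => ?_
    have hprod := prod_replaceRows (Matrix.of (kastEntry N v w E)) hb c σ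
    simp only [Matrix.of_apply] at hprod
    simp only [Matrix.transpose_apply]
    rw [mul_assoc, hprod]
    by_cases h : ∀ s, σ (b s) = c s
    · by_cases hσ : ∀ i, E i (σ i)
      · rw [if_pos h, if_pos ⟨hσ, h⟩]
        exact kasteleyn_sign_eq hwhite hblack hv hw hE hσ hτ
      · rw [if_pos h, if_neg fun H => hσ H.1]
        push Not at hσ
        obtain ⟨i, hi⟩ := hσ
        rw [Finset.prod_eq_zero (Finset.mem_univ i) (f := fun i => kastEntry N v w E i (σ i))
          (kastEntry_eq_zero hi), mul_zero]
    · rw [if_neg h, if_neg fun H => h H.2, mul_zero]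
  have habs := congrArg abs hdet
  rw [abs_mul, abs_mul, abs_mul, Finset.abs_prod, Finset.abs_prod,
    Finset.prod_eq_one fun s _ => abs_kastEntry (hbc s),
    Finset.prod_eq_one fun i _ => abs_kastEntry (hτ i)] at habs
  simpa using habs.symm

/-- If `G` has at least one perfect matching and `e 1, …, e m` are pairwise vertex-disjoint
edges of `G`, with `e s` joining the white vertex `v (b s)` to the black vertex `w (c s)`,
then the probability that a uniformly random perfect matching of `G` contains all the edges
`e s` equals the absolute value of the determinant of the `m×m` matrix whose `(s,t)` entry is
the `(c t, b s)` entry of the inverse of the Kasteleyn–Wilson matrix (over `ℚ`). -/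
theorem kasteleyn_inverse_probability (N m : ℕ) (v w : Fin N → ℤ × ℤ)
    (E : Fin N → Fin N → Prop)
    (hwhite : ∀ i, Even ((v i).1 + (v i).2)) (hblack : ∀ j, Odd ((w j).1 + (w j).2))
    (hv : Function.Injective v) (hw : Function.Injective w)
    (hE : ∀ i j, E i j → latAdj (v i) (w j))
    (hpm : ∃ M : (latGraph N E).Subgraph, M.IsPerfectMatching)
    (b c : Fin m → Fin N) (hb : Function.Injective b) (hc : Function.Injective c)
    (hbc : ∀ s, E (b s) (c s)) :
    (Nat.card {M : (latGraph N E).Subgraph //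
        M.IsPerfectMatching ∧ ∀ s, M.Adj (Sum.inl (b s)) (Sum.inr (c s))} : ℚ)
      / (Nat.card {M : (latGraph N E).Subgraph // M.IsPerfectMatching} : ℚ)
      = |(Matrix.of fun s t : Fin m =>
            ((Matrix.of fun i j : Fin N => (kastEntry N v w E i j : ℚ))⁻¹) (c t) (b s)).det| := by
  obtain ⟨M, hM⟩ := hpm
  obtain ⟨τ, hτ, -⟩ := exists_matchingOfPerm_eq hM
  have hcount := card_perm_eq_abs_det hwhite hblack hv hw hE hτ hb hbc
  have htotal := card_perm_eq_abs_det hwhite hblack hv hw hE hτ (b := Fin.elim0) (c := Fin.elim0)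
    (fun i => i.elim0) (fun i => i.elim0)
  rw [← card_perfectMatching_eq] at hcount htotal
  simp only [IsEmpty.forall_iff, and_true] at htotal
  have hrows : replaceRows (Matrix.of (kastEntry N v w E)) Fin.elim0 Fin.elim0 =
      Matrix.of (kastEntry N v w E) := by
    ext i j
    simp [replaceRows]
  rw [hrows] at htotal
  set K : Matrix (Fin N) (Fin N) ℚ := Matrix.of fun i j => (kastEntry N v w E i j : ℚ) with hKdef
  have hK : K = (Matrix.of (kastEntry N v w E)).map (Int.castRingHom ℚ) := rfl
  have hdetK : ((Matrix.of (kastEntry N v w E)).det : ℚ) = K.det := by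
    rw [hK]
    exact RingHom.map_det (Int.castRingHom ℚ) _
  have hdetR : ((replaceRows (Matrix.of (kastEntry N v w E)) b c).det : ℚ) =
      (replaceRows K b c).det := by
    have : replaceRows K b c =
        (replaceRows (Matrix.of (kastEntry N v w E)) b c).map (Int.castRingHom ℚ) := by
      ext i j
      simp only [replaceRows, hKdef, Matrix.of_apply, Matrix.map_apply]
      split_ifs <;> simp
    rw [this]
    exact RingHom.map_det (Int.castRingHom ℚ) _
  have hcount' := congrArg (Int.cast : ℤ → ℚ) hcount
  have htotal' := congrArg (Int.cast : ℤ → ℚ) htotal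
  rw [Int.cast_natCast, Int.cast_abs, hdetR] at hcount'
  rw [Int.cast_natCast, Int.cast_abs, hdetK] at htotal'
  have hpos : 0 < Nat.card {M : (latGraph N E).Subgraph // M.IsPerfectMatching} :=
    Nat.card_pos_iff.2 ⟨⟨⟨M, hM⟩⟩, inferInstance⟩
  have hne : |K.det| ≠ 0 := by
    rw [← htotal']
    exact_mod_cast hpos.ne'
  rw [hcount', htotal', det_replaceRows K (abs_ne_zero.1 hne).isUnit hb, abs_mul,
    mul_div_cancel_right₀ _ hne, ← Matrix.det_transpose]
  rfl
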